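/- Fix ε ∈ (0,1). For every even positive integer N and every Q > 0, the truncated singular series D(N,Q) = Σ_{q ≤ Q, q odd} μ(q)·C_q(−N)/φ(q)³ − Σ_{q ≤ Q, q even} μ(q)·C_q(−N)/φ(q)³ satisfies D(N,Q) = D(N) + O(Q^{−(1−ε)}), with an implied constant depending only on ε and uniform in N. -/

import Mathlib

open Finset Real
open scoped BigOperators Classical

/-- `e(x) = exp(2πix)`. -/
noncomputable def e (x : ℝ) : ℂ := Complex.exp (2 * Real.pi * Complex.I * x)

/-- The Ramanujan sum `C_q(m) = Σ_{a=1,(a,q)=1}^{q} e(ma/q)`. -/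
noncomputable def ramanujanC (q : ℕ) (m : ℤ) : ℂ :=
  ∑ a ∈ (Finset.Icc 1 q).filter (fun a => Nat.gcd a q = 1), e ((m : ℝ) * a / q)

/-- The general term `μ(q)·C_q(−N)/φ(q)³` of the singular series. -/
noncomputable def termD (N q : ℕ) : ℂ :=
  (ArithmeticFunction.moebius q : ℂ) * ramanujanC q (-(N : ℤ)) / (Nat.totient q : ℂ) ^ 3

/-- `D(N) = Σ_{q odd} μ(q)C_q(−N)/φ(q)³ − Σ_{q even} μ(q)C_q(−N)/φ(q)³`. -/
noncomputable def Dseries (N : ℕ) : ℂ :=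
  (∑' q : ℕ, if Odd q then termD N q else 0) - (∑' q : ℕ, if Even q then termD N q else 0)

/-- The truncation `D(N,Q)` of `D(N)` to moduli `q ≤ Q`. -/
noncomputable def Dtrunc (N : ℕ) (Q : ℝ) : ℂ :=
  (∑ q ∈ Finset.Icc 1 ⌊Q⌋₊, if Odd q then termD N q else 0) -
    (∑ q ∈ Finset.Icc 1 ⌊Q⌋₊, if Even q then termD N q else 0)

/-- For squarefree `q`, `φ(q)` is at least a constant times `q ^ (1 - δ)`. -/
lemma exists_rpow_le_mul_totient {δ : ℝ} (hδ : 0 < δ) :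
    ∃ B > (0 : ℝ), ∀ q : ℕ, Squarefree q → (q : ℝ) ^ (1 - δ) ≤ B * (Nat.totient q : ℝ) := by
  obtain ⟨K, hK⟩ := exists_nat_ge ((2 : ℝ) ^ (1 / δ))
  refine ⟨2 ^ K, by positivity, fun q hq => ?_⟩
  have hprod : ∏ p ∈ q.primeFactors, p = q := Nat.prod_primeFactors_of_squarefree hq
  have htot : (Nat.totient q : ℝ) = ∏ p ∈ q.primeFactors, ((p : ℝ) - 1) := by
    have h := Nat.totient_mul_prod_primeFactors q
    rw [hprod, mul_comm] at h
    rw [Nat.eq_of_mul_eq_mul_left (Nat.pos_of_ne_zero hq.ne_zero) h, Nat.cast_prod]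
    refine Finset.prod_congr rfl fun p hp => ?_
    rw [Nat.cast_sub (Nat.prime_of_mem_primeFactors hp).one_le, Nat.cast_one]
  have hpow : (q : ℝ) ^ (1 - δ) = ∏ p ∈ q.primeFactors, (p : ℝ) ^ (1 - δ) := by
    conv_lhs => rw [← hprod]
    rw [Nat.cast_prod, Real.finsetProd_rpow _ _ fun p _ => Nat.cast_nonneg p]
  have hfactor : ∀ p ∈ q.primeFactors,
      (p : ℝ) ^ (1 - δ) ≤ (if p < K then (2 : ℝ) else 1) * ((p : ℝ) - 1) := by
    intro p hp
    have hp2 : (2 : ℝ) ≤ p := by exact_mod_cast (Nat.prime_of_mem_primeFactors hp).two_le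
    have hp0 : (0 : ℝ) < p := by linarith
    split_ifs with h
    · calc (p : ℝ) ^ (1 - δ) ≤ (p : ℝ) ^ (1 : ℝ) :=
            Real.rpow_le_rpow_of_exponent_le (by linarith) (by linarith)
        _ = p := Real.rpow_one _
        _ ≤ _ := by linarith
    · have hKp : (2 : ℝ) ^ (1 / δ) ≤ p := hK.trans (by exact_mod_cast not_lt.mp h)
      have h2 : (2 : ℝ) ≤ (p : ℝ) ^ δ := by
        have := Real.rpow_le_rpow (by positivity) hKp hδ.le
        rwa [← Real.rpow_mul (by norm_num), one_div_mul_cancel hδ.ne', Real.rpow_one] at this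
      rw [Real.rpow_sub hp0, Real.rpow_one, div_le_iff₀ (by positivity)]
      nlinarith
  rw [hpow, htot]
  refine (Finset.prod_le_prod (fun p _ => by positivity) hfactor).trans ?_
  rw [Finset.prod_mul_distrib]
  refine mul_le_mul_of_nonneg_right ?_ (by rw [← htot]; positivity)
  rw [Finset.prod_ite, Finset.prod_const, Finset.prod_const_one, mul_one]
  refine pow_le_pow_right₀ (by norm_num) ?_
  calc _ ≤ (Finset.range K).card := Finset.card_le_card fun p hp => by
          simpa using (Finset.mem_filter.mp hp).2
    _ = K := Finset.card_range K

lemma norm_e (x : ℝ) : ‖e x‖ = 1 := by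
  rw [e, show (2 * Real.pi * Complex.I * x : ℂ) = ((2 * Real.pi * x : ℝ) : ℂ) * Complex.I by
    push_cast; ring]
  exact Complex.norm_exp_ofReal_mul_I _

lemma norm_ramanujanC_le (q : ℕ) (m : ℤ) : ‖ramanujanC q m‖ ≤ Nat.totient q := by
  refine (norm_sum_le _ _).trans ?_
  simp only [norm_e, Finset.sum_const, nsmul_eq_mul, mul_one]
  rw [← Nat.filter_coprime_Ico_eq_totient q 1]
  refine Nat.cast_le.mpr (Finset.card_le_card fun a ha => ?_)
  simp only [Finset.mem_filter, Finset.mem_Icc, Finset.mem_Ico] at ha ⊢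
  exact ⟨by omega, Nat.coprime_comm.mp ha.2⟩

lemma norm_termD_le (N q : ℕ) :
    ‖termD N q‖ ≤ |(ArithmeticFunction.moebius q : ℝ)| / (Nat.totient q : ℝ) ^ 2 := by
  rcases Nat.eq_zero_or_pos q with rfl | hq
  · simp [termD]
  have hφ : (0 : ℝ) < Nat.totient q := by exact_mod_cast Nat.totient_pos.mpr hq
  rw [termD, norm_div, norm_mul, norm_pow, Complex.norm_natCast, Complex.norm_intCast,
    div_le_div_iff₀ (by positivity) (by positivity)]
  calc _ ≤ |(ArithmeticFunction.moebius q : ℝ)| * Nat.totient q * (Nat.totient q : ℝ) ^ 2 := by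
        gcongr; exact norm_ramanujanC_le q _
    _ = _ := by ring

lemma exists_norm_termD_le {ε : ℝ} (hε : 0 < ε) :
    ∃ A > (0 : ℝ), ∀ N q : ℕ, ‖termD N q‖ ≤ A * (q : ℝ) ^ (-(2 - ε)) := by
  obtain ⟨B, hB, h⟩ := exists_rpow_le_mul_totient (half_pos hε)
  refine ⟨B ^ 2, by positivity, fun N q => (norm_termD_le N q).trans ?_⟩
  by_cases hq : Squarefree q
  · have hq0 : (0 : ℝ) < q := by exact_mod_cast Nat.pos_of_ne_zero hq.ne_zero
    have hφ : (0 : ℝ) < Nat.totient q := by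
      exact_mod_cast Nat.totient_pos.mpr (Nat.pos_of_ne_zero hq.ne_zero)
    have hμ : |(ArithmeticFunction.moebius q : ℝ)| ≤ 1 := by
      exact_mod_cast ArithmeticFunction.abs_moebius_le_one
    have hsq : (q : ℝ) ^ (2 - ε) = ((q : ℝ) ^ (1 - ε / 2)) ^ 2 := by
      rw [← Real.rpow_natCast, ← Real.rpow_mul hq0.le]
      congr 1; push_cast; ring
    rw [Real.rpow_neg hq0.le, ← div_eq_mul_inv, div_le_div_iff₀ (by positivity) (by positivity),
      hsq, ← mul_pow]
    calc _ ≤ 1 * ((q : ℝ) ^ (1 - ε / 2)) ^ 2 := by gcongr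
      _ ≤ _ := by rw [one_mul]; gcongr; exact h q hq
  · rw [ArithmeticFunction.moebius_eq_zero_of_not_squarefree hq]
    simp only [Int.cast_zero, abs_zero, zero_div]
    positivity

/-- The general term of the singular series, with sign `+` for odd and `-` for even moduli. -/
noncomputable def signedTermD (N q : ℕ) : ℂ :=
  (if Odd q then termD N q else 0) - (if Even q then termD N q else 0)

lemma norm_signedTermD (N q : ℕ) : ‖signedTermD N q‖ = ‖termD N q‖ := by
  rcases Nat.even_or_odd q with h | h
  · simp [signedTermD, h, Nat.not_odd_iff_even.mpr h]
  · simp [signedTermD, h, Nat.not_even_iff_odd.mpr h]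

lemma summable_norm_termD (N : ℕ) : Summable fun q => ‖termD N q‖ := by
  obtain ⟨A, -, hA⟩ := exists_norm_termD_le (ε := 1 / 2) (by norm_num)
  exact Summable.of_nonneg_of_le (fun _ => norm_nonneg _) (hA N)
    ((Real.summable_nat_rpow.mpr (by norm_num)).mul_left A)

lemma Dseries_eq_tsum (N : ℕ) : Dseries N = ∑' q, signedTermD N q := by
  have hsummable (P : ℕ → Prop) [DecidablePred P] : Summable fun q => if P q then termD N q else 0 :=
    Summable.of_norm_bounded (summable_norm_termD N) fun q => by
      split_ifs <;> simp
  exact ((hsummable Odd).tsum_sub (hsummable Even)).symm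

lemma Dtrunc_eq_sum_range (N : ℕ) (Q : ℝ) :
    Dtrunc N Q = ∑ q ∈ Finset.range (⌊Q⌋₊ + 1), signedTermD N q := by
  have h0 : signedTermD N 0 = 0 := by simp [signedTermD, termD]
  rw [Dtrunc, ← Finset.sum_sub_distrib, Finset.range_eq_Ico,
    Finset.sum_eq_sum_Ico_succ_bot (Nat.succ_pos _), h0, zero_add]
  rfl

theorem stmt6 (ε : ℝ) (hε : ε ∈ Set.Ioo (0 : ℝ) 1) :
    ∃ C > (0 : ℝ), ∀ N : ℕ, 0 < N → Even N → ∀ Q : ℝ, 0 < Q →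
      ‖Dtrunc N Q - Dseries N‖ ≤ C / Q ^ (1 - ε) := by
  obtain ⟨hε0, hε1⟩ := hε
  obtain ⟨A, hA, hbound⟩ := exists_norm_termD_le (half_pos hε0)
  have hsum : Summable fun q : ℕ => (q : ℝ) ^ (-(1 + ε / 2)) :=
    Real.summable_nat_rpow.mpr (by linarith)
  have hS : 0 < ∑' q : ℕ, (q : ℝ) ^ (-(1 + ε / 2)) :=
    hsum.tsum_pos (fun q => by positivity) 1 (by simp)
  refine ⟨A * ∑' q : ℕ, (q : ℝ) ^ (-(1 + ε / 2)), by positivity, fun N _ _ Q hQ => ?_⟩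
  have hsigned : Summable (signedTermD N) :=
    Summable.of_norm (by simpa only [norm_signedTermD] using summable_norm_termD N)
  set k := ⌊Q⌋₊ + 1 with hk
  have hshift := (summable_nat_add_iff k).mpr hsum
  have htail : ∀ i : ℕ, ‖signedTermD N (i + k)‖ ≤
      A / Q ^ (1 - ε) * ((i + k : ℕ) : ℝ) ^ (-(1 + ε / 2)) := by
    intro i
    have hQk : Q ≤ ((i + k : ℕ) : ℝ) := by
      have := (Nat.lt_floor_add_one Q).le
      push_cast [hk]
      linarith [(Nat.cast_nonneg i : (0 : ℝ) ≤ i)]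
    have hpos : (0 : ℝ) < ((i + k : ℕ) : ℝ) := hQ.trans_le hQk
    rw [norm_signedTermD, div_eq_mul_inv, mul_assoc, ← Real.rpow_neg hQ.le]
    refine (hbound N _).trans (mul_le_mul_of_nonneg_left ?_ hA.le)
    rw [show -(2 - ε / 2) = -(1 - ε) + -(1 + ε / 2) by ring, Real.rpow_add hpos]
    exact mul_le_mul_of_nonneg_right
      (Real.rpow_le_rpow_of_nonpos hQ hQk (by linarith)) (by positivity)
  rw [Dseries_eq_tsum, Dtrunc_eq_sum_range, ← hsigned.sum_add_tsum_nat_add k, sub_add_cancel_left,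
    norm_neg]
  refine (tsum_of_norm_bounded (hshift.mul_left _).hasSum htail).trans ?_
  rw [tsum_mul_left, mul_div_right_comm]
  refine mul_le_mul_of_nonneg_left ?_ (by positivity)
  rw [← hsum.sum_add_tsum_nat_add k]
  exact le_add_of_nonneg_left (Finset.sum_nonneg fun q _ => by positivity)
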